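/- Let $w \in A_\infty$, $0 < p_0 < p < \infty$, and $v \in A_{p/p_0}(w)$. Then for every measurable $F$ on $\mathbb{R}^{n+1}_+$, $\|\mathcal{C}_{w,p_0}F\|_{L^p(v\,dw)} \lesssim \|\mathcal{A}_w F\|_{L^p(v\,dw)}$, where $\mathcal{A}_w F(x) = \big(\iint_{|x-y|<t} |F(y,t)|^2 \frac{dw(y)\,dt}{t\,w(B(y,t))}\big)^{1/2}$ and $\mathcal{C}_{w,p_0}F(x_0) = \sup_{B \ni x_0}\big(\frac{1}{w(B)}\int_B \big(\int_0^{r_B}\int_{B(x,t)} |F(y,t)|^2 \frac{dw(y)\,dt}{t\,w(B(y,t))}\big)^{p_0/2}\,dw(x)\big)^{1/p_0}$. -/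

import Mathlib

open MeasureTheory Metric ENNReal NNReal Set

noncomputable section

/-- `w ∈ A_q` with constant at most `C` (for `1 ≤ q < ∞`), with respect to Lebesgue measure. -/
def apBound (n : ℕ) (w : EuclideanSpace ℝ (Fin n) → ℝ≥0∞) (q : ℝ) (C : ℝ≥0∞) : Prop :=
  ∀ (c : EuclideanSpace ℝ (Fin n)) (r : ℝ), 0 < r →
    (if q = 1 then
      ((∫⁻ x in ball c r, w x) / volume (ball c r)) *
        essSup (fun x => (w x)⁻¹) (volume.restrict (ball c r))
    else
      ((∫⁻ x in ball c r, w x) / volume (ball c r)) *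
        (((∫⁻ x in ball c r, (w x) ^ (-(1/(q-1)))) / volume (ball c r)) ^ (q - 1))) ≤ C

/-- `v ∈ A_q(w)` with constant at most `C` (for `1 ≤ q < ∞`), with respect to `dw = w dx`. -/
def apBoundW (n : ℕ) (w v : EuclideanSpace ℝ (Fin n) → ℝ≥0∞) (q : ℝ) (C : ℝ≥0∞) : Prop :=
  ∀ (c : EuclideanSpace ℝ (Fin n)) (r : ℝ), 0 < r →
    (if q = 1 then
      ((∫⁻ x in ball c r, v x * w x) / (∫⁻ x in ball c r, w x)) *
        essSup (fun x => (v x)⁻¹) ((volume.withDensity w).restrict (ball c r))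
    else
      ((∫⁻ x in ball c r, v x * w x) / (∫⁻ x in ball c r, w x)) *
        (((∫⁻ x in ball c r, (v x) ^ (-(1/(q-1))) * w x) /
            (∫⁻ x in ball c r, w x)) ^ (q - 1))) ≤ C

/-- Inner cone integral `∫_0^{r_B} ∫_{B(x,t)} |F(y,t)|² dw(y) dt /(t w(B(y,t)))`. -/
def innerCone (n : ℕ) (w : EuclideanSpace ℝ (Fin n) → ℝ≥0∞)
    (F : EuclideanSpace ℝ (Fin n) → ℝ → ℂ) (r : ℝ) (x : EuclideanSpace ℝ (Fin n)) : ℝ≥0∞ :=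
  ∫⁻ t in Ioc (0:ℝ) r,
    (∫⁻ y in ball x t,
      (‖F y t‖₊ : ℝ≥0∞) ^ 2 * w y / (∫⁻ z in ball y t, w z)) / ENNReal.ofReal t

/-- The Carleson-type maximal operator `𝒞_{w,p₀}`. -/
def carlWp (n : ℕ) (w : EuclideanSpace ℝ (Fin n) → ℝ≥0∞)
    (F : EuclideanSpace ℝ (Fin n) → ℝ → ℂ) (p0 : ℝ) (x0 : EuclideanSpace ℝ (Fin n)) : ℝ≥0∞ :=
  ⨆ (c : EuclideanSpace ℝ (Fin n)) (r : ℝ) (_ : 0 < r ∧ x0 ∈ ball c r),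
    ((∫⁻ x in ball c r, (innerCone n w F r x) ^ (p0/2) * w x) /
        (∫⁻ z in ball c r, w z)) ^ (1/p0)

/-- The conical square function `𝒜_w` of aperture 1. -/
def coneA (n : ℕ) (w : EuclideanSpace ℝ (Fin n) → ℝ≥0∞)
    (F : EuclideanSpace ℝ (Fin n) → ℝ → ℂ) (x : EuclideanSpace ℝ (Fin n)) : ℝ≥0∞ :=
  (∫⁻ t in Ioi (0:ℝ),
    (∫⁻ y in ball x t,
      (‖F y t‖₊ : ℝ≥0∞) ^ 2 * w y / (∫⁻ z in ball y t, w z)) / ENNReal.ofReal t) ^ ((1:ℝ)/2)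

section MaximalOperator

variable {X : Type*} [PseudoMetricSpace X] [MeasurableSpace X]

/-- A measure giving positive finite mass to every ball and satisfying
`μ (ball c (6 * r)) ≤ D * μ (ball c r)`. -/
structure IsBallDoubling (μ : Measure X) (D : ℝ≥0) : Prop where
  ne_zero : ∀ (c : X) (r : ℝ), 0 < r → μ (ball c r) ≠ 0
  ne_top : ∀ (c : X) (r : ℝ), 0 < r → μ (ball c r) ≠ ∞
  doubling : ∀ (c : X) (r : ℝ), 0 < r → μ (ball c (6 * r)) ≤ D * μ (ball c r)

/-- The uncentered Hardy–Littlewood maximal function with respect to `μ`. -/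
def uncenteredMaximal (μ : Measure X) (f : X → ℝ≥0∞) (x : X) : ℝ≥0∞ :=
  ⨆ (c : X) (r : ℝ) (_ : x ∈ ball c r), (∫⁻ y in ball c r, f y ∂μ) / μ (ball c r)

variable {μ : Measure X} {D : ℝ≥0}

theorem IsBallDoubling.isLocallyFiniteMeasure (hμ : IsBallDoubling μ D) :
    IsLocallyFiniteMeasure μ :=
  ⟨fun x => ⟨ball x 1, ball_mem_nhds x one_pos, (hμ.ne_top x 1 one_pos).lt_top⟩⟩

theorem le_uncenteredMaximal (f : X → ℝ≥0∞) {x c : X} {r : ℝ} (hx : x ∈ ball c r) :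
    (∫⁻ y in ball c r, f y ∂μ) / μ (ball c r) ≤ uncenteredMaximal μ f x :=
  le_iSup₂_of_le c r (le_iSup_of_le hx le_rfl)

theorem setOf_lt_uncenteredMaximal (f : X → ℝ≥0∞) (a : ℝ≥0∞) :
    {x | a < uncenteredMaximal μ f x} =
      ⋃ (i : X × ℝ) (_ : a < (∫⁻ y in ball i.1 i.2, f y ∂μ) / μ (ball i.1 i.2)),
        ball i.1 i.2 := by
  ext x
  simp only [uncenteredMaximal, mem_ofPred_eq, lt_iSup_iff, mem_iUnion, Prod.exists]
  constructor
  · rintro ⟨c, r, h, h'⟩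
    exact ⟨c, r, h', h⟩
  · rintro ⟨c, r, h, h'⟩
    exact ⟨c, r, h', h⟩

theorem measurable_uncenteredMaximal [OpensMeasurableSpace X] (f : X → ℝ≥0∞) :
    Measurable (uncenteredMaximal μ f) := by
  refine measurable_of_Ioi fun a => ?_
  change MeasurableSet {x | a < uncenteredMaximal μ f x}
  rw [setOf_lt_uncenteredMaximal]
  exact (isOpen_biUnion fun i _ => isOpen_ball).measurableSet

variable [OpensMeasurableSpace X] [SecondCountableTopology X]

/-- The weak type `(1, 1)` inequality. -/
theorem IsBallDoubling.mul_measure_lt_uncenteredMaximal_le (hμ : IsBallDoubling μ D)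
    (f : X → ℝ≥0∞) (a : ℝ≥0∞) :
    a * μ {x | a < uncenteredMaximal μ f x} ≤ D * ∫⁻ x, f x ∂μ := by
  let T : ℕ → Set (X × ℝ) := fun N =>
    {i | (0 < i.2 ∧ i.2 ≤ N) ∧ a < (∫⁻ y in ball i.1 i.2, f y ∂μ) / μ (ball i.1 i.2)}
  have hU : {x | a < uncenteredMaximal μ f x} = ⋃ N, ⋃ i ∈ T N, ball i.1 i.2 := by
    rw [setOf_lt_uncenteredMaximal]
    ext x
    simp only [mem_iUnion, exists_prop, T, mem_ofPred_eq]
    constructor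
    · rintro ⟨i, hi, hx⟩
      obtain ⟨N, hN⟩ := exists_nat_ge i.2
      exact ⟨N, i, ⟨⟨pos_of_mem_ball hx, hN⟩, hi⟩, hx⟩
    · rintro ⟨N, i, ⟨_, hi⟩, hx⟩
      exact ⟨i, hi, hx⟩
  have hmono : Monotone fun N => ⋃ i ∈ T N, ball i.1 i.2 := by
    intro N N' h
    refine biUnion_subset_biUnion_left fun i hi => ⟨⟨hi.1.1, hi.1.2.trans ?_⟩, hi.2⟩
    exact_mod_cast h
  rw [hU, hmono.measure_iUnion, ENNReal.mul_iSup]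
  refine iSup_le fun N => ?_
  obtain ⟨u, huT, hdisj, hcov⟩ := Vitali.exists_disjoint_subfamily_covering_enlargement_closedBall
    (T N) (fun i => i.1) (fun i => i.2) N (fun i hi => hi.1.2) 5 (by norm_num)
  have hdisj' : u.PairwiseDisjoint fun i => ball i.1 i.2 :=
    hdisj.mono_on fun i _ => ball_subset_closedBall
  have hcount : u.Countable := hdisj'.countable_of_isOpen (fun i _ => isOpen_ball)
    fun i hi => ⟨i.1, mem_ball_self (huT hi).1.1⟩
  have hsub : (⋃ i ∈ T N, ball i.1 i.2) ⊆ ⋃ i ∈ u, ball i.1 (6 * i.2) := by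
    refine iUnion₂_subset fun i hi => ?_
    obtain ⟨j, hj, hij⟩ := hcov i hi
    have hj0 := (huT hj).1.1
    exact (ball_subset_closedBall.trans (hij.trans
      (closedBall_subset_ball (by linarith)))).trans
      (subset_biUnion_of_mem (u := fun i : X × ℝ => ball i.1 (6 * i.2)) hj)
  calc a * μ (⋃ i ∈ T N, ball i.1 i.2)
      ≤ a * ∑' i : u, μ (ball i.1.1 (6 * i.1.2)) := by
        gcongr
        exact (measure_mono hsub).trans (measure_biUnion_le μ hcount _)
    _ = ∑' i : u, a * μ (ball i.1.1 (6 * i.1.2)) := ENNReal.tsum_mul_left.symm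
    _ ≤ ∑' i : u, D * ∫⁻ x in ball i.1.1 i.1.2, f x ∂μ := by
        refine ENNReal.tsum_le_tsum fun i => ?_
        have hi := huT i.2
        calc a * μ (ball i.1.1 (6 * i.1.2))
            ≤ a * (D * μ (ball i.1.1 i.1.2)) := by gcongr; exact hμ.doubling _ _ hi.1.1
          _ = D * (a * μ (ball i.1.1 i.1.2)) := by ring
          _ ≤ _ := by
            gcongr
            exact ENNReal.mul_le_of_le_div hi.2.le
    _ = D * ∫⁻ x in ⋃ i ∈ u, ball i.1 i.2, f x ∂μ := by
        rw [ENNReal.tsum_mul_left,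
          lintegral_biUnion hcount (fun i _ => measurableSet_ball) hdisj']
    _ ≤ D * ∫⁻ x, f x ∂μ := mul_le_mul_right (setLIntegral_le_lintegral _ _) _

theorem IsBallDoubling.mul_measure_lt_uncenteredMaximal_le_setLIntegral
    (hμ : IsBallDoubling μ D) {f : X → ℝ≥0∞} (hf : Measurable f) (a : ℝ≥0∞) :
    a * μ {x | a < uncenteredMaximal μ f x} ≤ 2 * D * ∫⁻ x in {x | a < 2 * f x}, f x ∂μ := by
  have hms : MeasurableSet {x | a < 2 * f x} := measurableSet_lt measurable_const (by fun_prop)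
  have hsub : {x | a < uncenteredMaximal μ f x} ⊆
      {x | a / 2 < uncenteredMaximal μ ({x | a < 2 * f x}.indicator f) x} := by
    intro x hx
    have hx' : a < uncenteredMaximal μ f x := hx
    simp only [uncenteredMaximal, lt_iSup_iff] at hx'
    obtain ⟨c, r, hxr, h⟩ := hx'
    refine lt_of_lt_of_le ?_ (le_uncenteredMaximal _ hxr)
    have hr := pos_of_mem_ball hxr
    have h0 := hμ.ne_zero c r hr
    have ht := hμ.ne_top c r hr
    by_contra! hcon
    refine absurd h (not_lt.2 ?_)
    rw [ENNReal.div_le_iff h0 ht] at hcon ⊢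
    calc ∫⁻ y in ball c r, f y ∂μ
        ≤ ∫⁻ y in ball c r, ({x | a < 2 * f x}.indicator f y + a / 2) ∂μ := by
          refine lintegral_mono fun y => ?_
          by_cases hy : a < 2 * f y
          · rw [indicator_of_mem (show y ∈ {x | a < 2 * f x} from hy)]
            exact le_self_add
          · rw [indicator_of_notMem (show y ∉ {x | a < 2 * f x} from hy), zero_add,
              ENNReal.le_div_iff_mul_le (by simp) (by simp), mul_comm]
            exact not_lt.1 hy
      _ = (∫⁻ y in ball c r, {x | a < 2 * f x}.indicator f y ∂μ) + a / 2 * μ (ball c r) := by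
          rw [lintegral_add_right _ measurable_const, setLIntegral_const]
      _ ≤ a / 2 * μ (ball c r) + a / 2 * μ (ball c r) := by gcongr
      _ = a * μ (ball c r) := by rw [← add_mul, ENNReal.add_halves]
  have hweak := hμ.mul_measure_lt_uncenteredMaximal_le ({x | a < 2 * f x}.indicator f) (a / 2)
  rw [lintegral_indicator hms] at hweak
  calc a * μ {x | a < uncenteredMaximal μ f x}
      = 2 * (a / 2 * μ {x | a < uncenteredMaximal μ f x}) := by
        rw [← mul_assoc, ENNReal.mul_div_cancel (by simp) (by simp)]
    _ ≤ 2 * (D * ∫⁻ x in {x | a < 2 * f x}, f x ∂μ) := by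
        exact mul_le_mul_right ((mul_le_mul_right (measure_mono hsub) _).trans hweak) _
    _ = _ := by ring

end MaximalOperator

theorem setLIntegral_ofReal_rpow_sub_one {s : ℝ} (hs : 0 < s) (a : ℝ≥0∞) :
    ∫⁻ t in Ioi (0 : ℝ),
      {t | ENNReal.ofReal t < a}.indicator (fun t => ENNReal.ofReal (t ^ (s - 1))) t =
      a ^ s / ENNReal.ofReal s := by
  have hs' : ENNReal.ofReal s ≠ 0 := by simpa using hs
  have key : ∀ b : ℝ≥0, ∫⁻ t in Ioi (0 : ℝ),
      {t | ENNReal.ofReal t < b}.indicator (fun t => ENNReal.ofReal (t ^ (s - 1))) t =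
      (b : ℝ≥0∞) ^ s / ENNReal.ofReal s := by
    intro b
    have h := lintegral_rpow_eq_lintegral_meas_lt_mul (Measure.dirac ())
      (f := fun _ => (b : ℝ)) (by filter_upwards with _; exact b.2) (by fun_prop) hs
    rw [lintegral_const, Measure.dirac_apply_of_mem (mem_univ _), mul_one,
      ← ENNReal.ofReal_rpow_of_nonneg b.coe_nonneg hs.le] at h
    rw [ENNReal.eq_div_iff hs' ENNReal.ofReal_ne_top]
    rw [ENNReal.ofReal_coe_nnreal] at h
    rw [h]
    congr 1
    refine setLIntegral_congr_fun measurableSet_Ioi fun t ht => ?_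
    have ht0 : 0 < t := ht
    have hiff : ENNReal.ofReal t < b ↔ t < b := by
      rw [← ENNReal.ofReal_coe_nnreal, ENNReal.ofReal_lt_ofReal_iff_of_nonneg ht0.le]
    by_cases htb : t < b
    · simp [indicator, hiff, htb]
    · simp [indicator, hiff, htb]
  induction a with
  | coe b => exact key b
  | top =>
    rw [ENNReal.top_rpow_of_pos hs, ENNReal.top_div_of_ne_top ENNReal.ofReal_ne_top,
      eq_top_iff]
    refine ENNReal.le_of_forall_nnreal_lt fun b _ => ?_
    have h0 : ((b : ℝ≥0∞) * ENNReal.ofReal s) ≠ ∞ :=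
      ENNReal.mul_ne_top ENNReal.coe_ne_top ENNReal.ofReal_ne_top
    have h1 : (((b : ℝ≥0∞) * ENNReal.ofReal s) ^ (1 / s)) ≠ ∞ :=
      ENNReal.rpow_ne_top_of_nonneg (by positivity) h0
    calc (b : ℝ≥0∞) = (((b : ℝ≥0∞) * ENNReal.ofReal s) ^ (1 / s)) ^ s / ENNReal.ofReal s := by
          rw [← ENNReal.rpow_mul, one_div_mul_cancel hs.ne', ENNReal.rpow_one,
            ENNReal.mul_div_cancel_right hs' ENNReal.ofReal_ne_top]
      _ ≤ _ := by
          lift (((b : ℝ≥0∞) * ENNReal.ofReal s) ^ (1 / s)) to ℝ≥0 using h1 with c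
          rw [← key c]
          refine lintegral_mono fun t => indicator_le_indicator_of_subset ?_ (by simp) t
          intro t _
          exact ENNReal.ofReal_lt_top

/-- Integrating `t ^ (s - 1)` over the superlevel sets of `g` against a measurable weight. -/
theorem lintegral_mul_rpow_eq_setLIntegral {X : Type*} [MeasurableSpace X] {μ : Measure X} [SFinite μ] {s : ℝ} (hs : 0 < s) {f g : X → ℝ≥0∞}
    (hf : Measurable f) (hg : Measurable g) :
    ∫⁻ x, f x * (g x ^ s / ENNReal.ofReal s) ∂μ =
      ∫⁻ t in Ioi (0 : ℝ), ENNReal.ofReal (t ^ (s - 1)) *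
        ∫⁻ x in {x | ENNReal.ofReal t < g x}, f x ∂μ := by
  have hms : MeasurableSet {z : X × ℝ | ENNReal.ofReal z.2 < g z.1} :=
    measurableSet_lt (by fun_prop) (by fun_prop)
  calc ∫⁻ x, f x * (g x ^ s / ENNReal.ofReal s) ∂μ
      = ∫⁻ x, (∫⁻ t in Ioi (0 : ℝ), {z : X × ℝ | ENNReal.ofReal z.2 < g z.1}.indicator
          (fun z => f z.1 * ENNReal.ofReal (z.2 ^ (s - 1))) (x, t)) ∂μ := by
        refine lintegral_congr fun x => ?_
        rw [← setLIntegral_ofReal_rpow_sub_one hs, ← lintegral_const_mul]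
        · refine lintegral_congr fun t => ?_
          by_cases h : ENNReal.ofReal t < g x <;> simp [indicator, h]
        · exact Measurable.indicator (by fun_prop)
            (measurableSet_lt (by fun_prop) measurable_const)
    _ = ∫⁻ t in Ioi (0 : ℝ), ∫⁻ x, {z : X × ℝ | ENNReal.ofReal z.2 < g z.1}.indicator
          (fun z => f z.1 * ENNReal.ofReal (z.2 ^ (s - 1))) (x, t) ∂μ := by
        refine lintegral_lintegral_swap ?_
        exact (Measurable.indicator (by fun_prop) hms).aemeasurable
    _ = _ := by
        refine lintegral_congr fun t => ?_
        rw [← lintegral_const_mul _ hf, ← lintegral_indicator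
          (measurableSet_lt measurable_const hg)]
        refine lintegral_congr fun x => ?_
        by_cases h : ENNReal.ofReal t < g x <;> simp [indicator, h, mul_comm]

/-- The constant in the strong type `(s, s)` inequality for the uncentered maximal function. -/
def strongTypeConst (D : ℝ≥0) (s : ℝ) : ℝ≥0∞ :=
  ENNReal.ofReal s * (2 * D * (2 ^ (s - 1) / ENNReal.ofReal (s - 1)))

theorem strongTypeConst_ne_top (D : ℝ≥0) {s : ℝ} (hs : 1 < s) : strongTypeConst D s ≠ ∞ := by
  have h : ENNReal.ofReal (s - 1) ≠ 0 := by simpa using hs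
  have h2 : (2 : ℝ≥0∞) ^ (s - 1) ≠ ∞ :=
    ENNReal.rpow_ne_top_of_nonneg (by linarith) (by simp)
  exact ENNReal.mul_ne_top ENNReal.ofReal_ne_top (ENNReal.mul_ne_top
    (ENNReal.mul_ne_top (by simp) (by simp)) (ENNReal.div_ne_top h2 h))

section StrongType

variable {X : Type*} [PseudoMetricSpace X] [MeasurableSpace X] [OpensMeasurableSpace X]
  [SecondCountableTopology X] {μ : Measure X} {D : ℝ≥0}

/-- The strong type `(s, s)` inequality for `1 < s < ∞`. -/
theorem IsBallDoubling.lintegral_uncenteredMaximal_rpow_le (hμ : IsBallDoubling μ D) {s : ℝ}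
    (hs : 1 < s) {f : X → ℝ≥0∞} (hf : Measurable f) :
    ∫⁻ x, uncenteredMaximal μ f x ^ s ∂μ ≤ strongTypeConst D s * ∫⁻ x, f x ^ s ∂μ := by
  have := hμ.isLocallyFiniteMeasure
  have hs0 : 0 < s := by linarith
  have hs1 : 0 < s - 1 := by linarith
  have hs0' : ENNReal.ofReal s ≠ 0 := by simpa using hs0
  calc ∫⁻ x, uncenteredMaximal μ f x ^ s ∂μ
      = ENNReal.ofReal s *
          ∫⁻ x, 1 * (uncenteredMaximal μ f x ^ s / ENNReal.ofReal s) ∂μ := by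
        rw [← lintegral_const_mul' _ _ ENNReal.ofReal_ne_top]
        refine lintegral_congr fun x => ?_
        rw [one_mul, ENNReal.mul_div_cancel hs0' ENNReal.ofReal_ne_top]
    _ = ENNReal.ofReal s * ∫⁻ t in Ioi (0 : ℝ), ENNReal.ofReal (t ^ (s - 1)) *
          μ {x | ENNReal.ofReal t < uncenteredMaximal μ f x} := by
        rw [lintegral_mul_rpow_eq_setLIntegral hs0 measurable_const
          (measurable_uncenteredMaximal f)]
        simp
    _ ≤ ENNReal.ofReal s * ∫⁻ t in Ioi (0 : ℝ), 2 * D * (ENNReal.ofReal (t ^ (s - 1 - 1)) *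
          ∫⁻ x in {x | ENNReal.ofReal t < 2 * f x}, f x ∂μ) := by
        refine mul_le_mul_right (setLIntegral_mono' measurableSet_Ioi fun t ht => ?_) _
        have ht0 : (0 : ℝ) < t := ht
        have hpow : ENNReal.ofReal (t ^ (s - 1)) =
            ENNReal.ofReal (t ^ (s - 1 - 1)) * ENNReal.ofReal t := by
          rw [← ENNReal.ofReal_mul (by positivity), ← Real.rpow_add_one ht0.ne']
          congr 2
          ring
        rw [hpow, mul_assoc, mul_left_comm (2 * (D : ℝ≥0∞))]
        exact mul_le_mul_right (hμ.mul_measure_lt_uncenteredMaximal_le_setLIntegral hf _) _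
    _ = ENNReal.ofReal s * (2 * D *
          ∫⁻ x, f x * ((2 * f x) ^ (s - 1) / ENNReal.ofReal (s - 1)) ∂μ) := by
        rw [lintegral_mul_rpow_eq_setLIntegral hs1 hf (by fun_prop),
          lintegral_const_mul' _ _ (ENNReal.mul_ne_top (by simp) (by simp))]
    _ = strongTypeConst D s * ∫⁻ x, f x ^ s ∂μ := by
        have hpt : ∀ x, f x * ((2 * f x) ^ (s - 1) / ENNReal.ofReal (s - 1)) =
            2 ^ (s - 1) / ENNReal.ofReal (s - 1) * f x ^ s := by
          intro x
          have : f x ^ s = f x * f x ^ (s - 1) := by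
            conv_lhs => rw [show s = 1 + (s - 1) by ring]
            rw [ENNReal.rpow_add_of_nonneg _ _ zero_le_one hs1.le, ENNReal.rpow_one]
          rw [this, ENNReal.mul_rpow_of_nonneg _ _ hs1.le, ENNReal.div_eq_inv_mul,
            ENNReal.div_eq_inv_mul]
          ring
        simp_rw [hpt]
        rw [lintegral_const_mul _ (by fun_prop), strongTypeConst]
        ring

end StrongType

/-- Hölder's inequality for a weight and its dual weight. -/
theorem measure_univ_rpow_le_lintegral_mul_lintegral_dual {X : Type*} [MeasurableSpace X]
    {μ : Measure X} {s : ℝ} (hs : 1 < s) {v : X → ℝ≥0∞} (hv : Measurable v)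
    (hv0 : ∀ᵐ x ∂μ, v x ≠ 0 ∧ v x ≠ ∞) :
    μ univ ^ s ≤ (∫⁻ x, v x ∂μ) * (∫⁻ x, v x ^ (-(1 / (s - 1))) ∂μ) ^ (s - 1) := by
  have hs0 : 0 < s := by linarith
  have hs1 : 0 < s - 1 := by linarith
  have hconj : s.HolderConjugate (s / (s - 1)) := Real.HolderConjugate.conjExponent hs
  have h := ENNReal.lintegral_mul_le_Lp_mul_Lq μ hconj
    (f := fun x => v x ^ (1 / s)) (g := fun x => v x ^ (-(1 / s))) (by fun_prop) (by fun_prop)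
  have h1 : ∫⁻ x, ((fun x => v x ^ (1 / s)) * fun x => v x ^ (-(1 / s))) x ∂μ = μ univ := by
    rw [← lintegral_one]
    refine lintegral_congr_ae ?_
    filter_upwards [hv0] with x hx
    simp only [Pi.mul_apply]
    rw [← ENNReal.rpow_add _ _ hx.1 hx.2, add_neg_cancel, ENNReal.rpow_zero]
  have e1 : (1 / s) * s = 1 := one_div_mul_cancel hs0.ne'
  have e2 : -(1 / s) * (s / (s - 1)) = -(1 / (s - 1)) := by field_simp
  have e3 : 1 / (s / (s - 1)) * s = s - 1 := by field_simp
  simp only [h1, ← ENNReal.rpow_mul, e1, e2, ENNReal.rpow_one] at h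
  calc μ univ ^ s ≤ _ := ENNReal.rpow_le_rpow h hs0.le
    _ = _ := by
      rw [ENNReal.mul_rpow_of_nonneg _ _ hs0.le, ← ENNReal.rpow_mul, ← ENNReal.rpow_mul, e1, e3,
        ENNReal.rpow_one]

/-- The `A_s` condition on balls for the weight `v` relative to the measure `μ`. -/
def IsBallMuckenhoupt {X : Type*} [PseudoMetricSpace X] [MeasurableSpace X] (μ : Measure X)
    (v : X → ℝ≥0∞) (s : ℝ) (K : ℝ≥0) : Prop :=
  ∀ (c : X) (r : ℝ), 0 < r → (∫⁻ x in ball c r, v x ∂μ) *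
    (∫⁻ x in ball c r, v x ^ (-(1 / (s - 1))) ∂μ) ^ (s - 1) ≤ K * μ (ball c r) ^ s

theorem ae_of_forall_ae_restrict_ball {X : Type*} [PseudoMetricSpace X] [MeasurableSpace X]
    {μ : Measure X} {P : X → Prop} (c : X) (r : ℝ)
    (h : ∀ R, r ≤ R → ∀ᵐ x ∂μ.restrict (ball c R), P x) : ∀ᵐ x ∂μ, P x := by
  have hU : (⋃ N : ℕ, ball c (r + N)) = univ := by
    refine eq_univ_of_forall fun x => mem_iUnion.2 ?_
    obtain ⟨N, hN⟩ := exists_nat_gt (dist x c - r)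
    exact ⟨N, by rw [mem_ball]; linarith⟩
  have h' := (ae_restrict_iUnion_iff (μ := μ) (fun N : ℕ => ball c (r + N)) P).2
    fun N => h _ (by simp)
  rwa [hU, Measure.restrict_univ] at h'

section Muckenhoupt

variable {X : Type*} [PseudoMetricSpace X] [MeasurableSpace X]
  {μ : Measure X} {D K : ℝ≥0} {s : ℝ} {v : X → ℝ≥0∞}

theorem ae_ne_zero_and_ne_top_of_setLIntegral_ball_ne_top (hs : 1 < s) (hv : Measurable v)
    (hV : ∀ (c : X) (r : ℝ), 0 < r → ∫⁻ x in ball c r, v x ∂μ ≠ ∞)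
    (hS : ∀ (c : X) (r : ℝ), 0 < r → ∫⁻ x in ball c r, v x ^ (-(1 / (s - 1))) ∂μ ≠ ∞) :
    ∀ᵐ x ∂μ, v x ≠ 0 ∧ v x ≠ ∞ := by
  rcases isEmpty_or_nonempty X with hX | ⟨⟨c⟩⟩
  · exact .of_forall fun x => (hX.false x).elim
  refine ae_of_forall_ae_restrict_ball c 1 fun R hR => ?_
  have hR0 : 0 < R := by linarith
  filter_upwards [ae_lt_top hv (hV c R hR0), ae_lt_top (by fun_prop) (hS c R hR0)] with x h1 h2
  refine ⟨fun h0 => ?_, h1.ne⟩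
  have : 0 < 1 / (s - 1) := by
    have : 0 < s - 1 := by linarith
    positivity
  rw [h0, ENNReal.zero_rpow_of_neg (by linarith)] at h2
  exact h2.ne rfl

theorem IsBallMuckenhoupt.ae_eq_top (hA : IsBallMuckenhoupt μ v s K) (hμ : IsBallDoubling μ D)
    (hs : 1 < s) (hv : Measurable v) {c : X} {r : ℝ} (hr : 0 < r)
    (h : ∫⁻ x in ball c r, v x ∂μ = ∞) : ∀ᵐ x ∂μ, v x = ∞ := by
  have hs0 : 0 < s := by linarith
  have hs1 : 0 < s - 1 := by linarith
  refine ae_of_forall_ae_restrict_ball c r fun R hR => ?_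
  have hR0 : 0 < R := hr.trans_le hR
  have hRtop : ∫⁻ x in ball c R, v x ∂μ = ∞ :=
    eq_top_iff.2 (h ▸ lintegral_mono_set (ball_subset_ball hR))
  have h1 := hA c R hR0
  have h2 : (∫⁻ x in ball c R, v x ^ (-(1 / (s - 1))) ∂μ) ^ (s - 1) = 0 := by
    by_contra hne
    rw [hRtop, ENNReal.top_mul hne] at h1
    exact ENNReal.mul_ne_top ENNReal.coe_ne_top
      (ENNReal.rpow_ne_top_of_nonneg hs0.le (hμ.ne_top c R hR0)) (top_le_iff.1 h1)
  rw [ENNReal.rpow_eq_zero_iff_of_pos hs1, lintegral_eq_zero_iff (by fun_prop)] at h2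
  filter_upwards [h2] with x hx
  have hneg : ¬ (s - 1 < 0) := by linarith
  simpa [ENNReal.rpow_eq_zero_iff, hs1, hneg] using hx

theorem IsBallMuckenhoupt.ae_eq_zero (hA : IsBallMuckenhoupt μ v s K) (hμ : IsBallDoubling μ D)
    (hs : 1 < s) (hv : Measurable v) {c : X} {r : ℝ} (hr : 0 < r)
    (h : ∫⁻ x in ball c r, v x ^ (-(1 / (s - 1))) ∂μ = ∞) : ∀ᵐ x ∂μ, v x = 0 := by
  have hs0 : 0 < s := by linarith
  have hs1 : 0 < s - 1 := by linarith
  refine ae_of_forall_ae_restrict_ball c r fun R hR => ?_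
  have hR0 : 0 < R := hr.trans_le hR
  have hRtop : ∫⁻ x in ball c R, v x ^ (-(1 / (s - 1))) ∂μ = ∞ :=
    eq_top_iff.2 (h ▸ lintegral_mono_set (ball_subset_ball hR))
  have h1 := hA c R hR0
  have h2 : ∫⁻ x in ball c R, v x ∂μ = 0 := by
    by_contra hne
    rw [hRtop, ENNReal.top_rpow_of_pos hs1, ENNReal.mul_top hne] at h1
    exact ENNReal.mul_ne_top ENNReal.coe_ne_top
      (ENNReal.rpow_ne_top_of_nonneg hs0.le (hμ.ne_top c R hR0)) (top_le_iff.1 h1)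
  rw [lintegral_eq_zero_iff hv] at h2
  exact h2

theorem IsBallMuckenhoupt.isBallDoubling_withDensity [OpensMeasurableSpace X]
    (hA : IsBallMuckenhoupt μ v s K)
    (hμ : IsBallDoubling μ D) (hs : 1 < s) (hv : Measurable v)
    (hV : ∀ (c : X) (r : ℝ), 0 < r → ∫⁻ x in ball c r, v x ∂μ ≠ ∞)
    (hS : ∀ (c : X) (r : ℝ), 0 < r → ∫⁻ x in ball c r, v x ^ (-(1 / (s - 1))) ∂μ ≠ ∞) :
    IsBallDoubling (μ.withDensity v) (K * D ^ s) ∧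
      IsBallDoubling (μ.withDensity fun x => v x ^ (-(1 / (s - 1))))
        ((K * D ^ s) ^ (1 / (s - 1))) := by
  have hs0 : 0 < s := by linarith
  have hs1 : 0 < s - 1 := by linarith
  have hae := ae_ne_zero_and_ne_top_of_setLIntegral_ball_ne_top hs hv hV hS
  have hne : ∀ (u : X → ℝ≥0∞), Measurable u → (∀ᵐ x ∂μ, u x ≠ 0) → ∀ (c : X) (r : ℝ), 0 < r →
      ∫⁻ x in ball c r, u x ∂μ ≠ 0 := by
    intro u hu hu0 c r hr h
    rw [lintegral_eq_zero_iff hu] at h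
    have : ∀ᵐ x ∂μ.restrict (ball c r), False := by
      filter_upwards [h, ae_restrict_of_ae hu0] with x h1 h2 using h2 h1
    have : μ.restrict (ball c r) univ = 0 := by simpa [ae_iff] using this
    rw [Measure.restrict_apply_univ] at this
    exact hμ.ne_zero c r hr this
  have hV0 := hne v hv (hae.mono fun x hx => hx.1)
  have hS0 := hne (fun x => v x ^ (-(1 / (s - 1)))) (by fun_prop) (hae.mono fun x hx h0 => by
    have hneg : ¬ (s - 1 < 0) := by linarith
    simp [ENNReal.rpow_eq_zero_iff, hs1, hneg, hx] at h0)
  have hlow : ∀ (c : X) (r : ℝ), μ (ball c r) ^ s ≤ (∫⁻ x in ball c r, v x ∂μ) *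
      (∫⁻ x in ball c r, v x ^ (-(1 / (s - 1))) ∂μ) ^ (s - 1) := by
    intro c r
    rw [← Measure.restrict_apply_univ]
    exact measure_univ_rpow_le_lintegral_mul_lintegral_dual hs hv (ae_restrict_of_ae hae)
  have hup : ∀ (c : X) (r : ℝ), 0 < r → (∫⁻ x in ball c (6 * r), v x ∂μ) *
      (∫⁻ x in ball c (6 * r), v x ^ (-(1 / (s - 1))) ∂μ) ^ (s - 1) ≤
      (K * D ^ s : ℝ≥0) * ((∫⁻ x in ball c r, v x ∂μ) *
      (∫⁻ x in ball c r, v x ^ (-(1 / (s - 1))) ∂μ) ^ (s - 1)) := by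
    intro c r hr
    calc _ ≤ K * μ (ball c (6 * r)) ^ s := hA c (6 * r) (by positivity)
      _ ≤ K * (D * μ (ball c r)) ^ s := by gcongr; exact hμ.doubling c r hr
      _ = (K * D ^ s : ℝ≥0) * μ (ball c r) ^ s := by
        rw [ENNReal.mul_rpow_of_nonneg _ _ hs0.le, ENNReal.coe_mul,
          ENNReal.coe_rpow_of_nonneg _ hs0.le, mul_assoc]
      _ ≤ _ := by gcongr; exact hlow c r
  refine ⟨⟨fun c r hr => ?_, fun c r hr => ?_, fun c r hr => ?_⟩,
    ⟨fun c r hr => ?_, fun c r hr => ?_, fun c r hr => ?_⟩⟩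
  · rw [withDensity_apply _ measurableSet_ball]; exact hV0 c r hr
  · rw [withDensity_apply _ measurableSet_ball]; exact hV c r hr
  · rw [withDensity_apply _ measurableSet_ball, withDensity_apply _ measurableSet_ball]
    have h6 : 0 < 6 * r := by positivity
    refine (ENNReal.mul_le_mul_iff_left
      (by rw [Ne, ENNReal.rpow_eq_zero_iff_of_pos hs1]; exact hS0 c _ h6)
      (ENNReal.rpow_ne_top_of_nonneg hs1.le (hS c _ h6))).1 ?_
    rw [mul_assoc]
    refine (hup c r hr).trans ?_
    gcongr
    linarith
  · rw [withDensity_apply _ measurableSet_ball]; exact hS0 c r hr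
  · rw [withDensity_apply _ measurableSet_ball]; exact hS c r hr
  · rw [withDensity_apply _ measurableSet_ball, withDensity_apply _ measurableSet_ball]
    have h6 : 0 < 6 * r := by positivity
    rw [← ENNReal.rpow_le_rpow_iff hs1, ENNReal.mul_rpow_of_nonneg _ _ hs1.le,
      ENNReal.coe_rpow_of_nonneg _ (by positivity), ← ENNReal.rpow_mul,
      one_div_mul_cancel hs1.ne', ENNReal.rpow_one,
      ← ENNReal.mul_le_mul_iff_right (hV0 c _ h6) (hV c _ h6)]
    refine (hup c r hr).trans ?_
    rw [mul_left_comm]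
    gcongr
    linarith

end Muckenhoupt

section WeightedMaximal

variable {X : Type*} [PseudoMetricSpace X] [MeasurableSpace X] [OpensMeasurableSpace X]
  {μ : Measure X} {D K : ℝ≥0} {s : ℝ} {v : X → ℝ≥0∞}

/-- The maximal function with respect to `μ` is controlled by the composition of the maximal
functions adapted to the weight and to its dual weight. -/
theorem IsBallMuckenhoupt.uncenteredMaximal_rpow_le (hA : IsBallMuckenhoupt μ v s K)
    (hμ : IsBallDoubling μ D) (hs : 1 < s) (hv : Measurable v)
    (hV : ∀ (c : X) (r : ℝ), 0 < r → ∫⁻ x in ball c r, v x ∂μ ≠ ∞)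
    (hS : ∀ (c : X) (r : ℝ), 0 < r → ∫⁻ x in ball c r, v x ^ (-(1 / (s - 1))) ∂μ ≠ ∞)
    {f : X → ℝ≥0∞} (hf : Measurable f) (x : X) :
    uncenteredMaximal μ f x ^ (s - 1) ≤
      K * uncenteredMaximal (μ.withDensity v) (fun y =>
        uncenteredMaximal (μ.withDensity fun z => v z ^ (-(1 / (s - 1))))
          (fun z => f z / v z ^ (-(1 / (s - 1)))) y ^ (s - 1) / v y) x := by
  have hs0 : 0 < s := by linarith
  have hs1 : 0 < s - 1 := by linarith
  have hae := ae_ne_zero_and_ne_top_of_setLIntegral_ball_ne_top hs hv hV hS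
  obtain ⟨hdV, hdS⟩ := hA.isBallDoubling_withDensity hμ hs hv hV hS
  set σ : X → ℝ≥0∞ := fun z => v z ^ (-(1 / (s - 1))) with hσ
  have hσm : Measurable σ := by fun_prop
  set H := uncenteredMaximal (μ.withDensity σ) (fun z => f z / σ z) with hH
  have hHm : Measurable H := measurable_uncenteredMaximal _
  set k : X → ℝ≥0∞ := fun y => H y ^ (s - 1) / v y with hk
  have hkm : Measurable k := by fun_prop
  have hσae : ∀ᵐ z ∂μ, σ z ≠ 0 ∧ σ z ≠ ∞ := by
    filter_upwards [hae] with z hz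
    exact ⟨(ENNReal.rpow_pos hz.1.bot_lt hz.2).ne', ENNReal.rpow_ne_top_of_ne_zero hz.1 hz.2⟩
  rw [← ENNReal.le_rpow_inv_iff hs1]
  refine iSup₂_le fun c r => iSup_le fun hx => ?_
  rw [ENNReal.le_rpow_inv_iff hs1]
  have hr := pos_of_mem_ball hx
  have hm0 := hμ.ne_zero c r hr
  have hmt := hμ.ne_top c r hr
  have hV0 := hdV.ne_zero c r hr
  have hVt := hdV.ne_top c r hr
  have hS0 := hdS.ne_zero c r hr
  have hSt := hdS.ne_top c r hr
  have hAB := hA c r hr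
  rw [← withDensity_apply _ measurableSet_ball, ← withDensity_apply _ measurableSet_ball] at hAB
  have hf' : ∫⁻ z in ball c r, f z / σ z ∂(μ.withDensity σ) = ∫⁻ z in ball c r, f z ∂μ := by
    rw [restrict_withDensity measurableSet_ball,
      lintegral_withDensity_eq_lintegral_mul _ hσm (by fun_prop)]
    refine lintegral_congr_ae (ae_restrict_of_ae ?_)
    filter_upwards [hσae] with z hz using ENNReal.mul_div_cancel hz.1 hz.2
  have hk' : ∫⁻ z in ball c r, k z ∂(μ.withDensity v) = ∫⁻ z in ball c r, H z ^ (s - 1) ∂μ := by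
    rw [restrict_withDensity measurableSet_ball,
      lintegral_withDensity_eq_lintegral_mul _ hv hkm]
    refine lintegral_congr_ae (ae_restrict_of_ae ?_)
    filter_upwards [hae] with z hz using ENNReal.mul_div_cancel hz.1 hz.2
  set m := μ (ball c r)
  set V := μ.withDensity v (ball c r)
  set S := μ.withDensity σ (ball c r)
  set I := ∫⁻ z in ball c r, f z ∂μ
  set M := uncenteredMaximal (μ.withDensity v) k x
  have h1 : (I / S) ^ (s - 1) * m ≤ M * V := by
    have h := le_uncenteredMaximal (μ := μ.withDensity v) k hx
    rw [ENNReal.div_le_iff hV0 hVt, hk'] at h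
    refine le_trans ?_ h
    rw [← setLIntegral_const]
    refine setLIntegral_mono' measurableSet_ball fun z hz => ?_
    have h2 := le_uncenteredMaximal (μ := μ.withDensity σ) (fun z => f z / σ z) hz
    rw [hf'] at h2
    exact ENNReal.rpow_le_rpow h2 hs1.le
  have hI : I ^ (s - 1) = (I / S) ^ (s - 1) * S ^ (s - 1) := by
    rw [← ENNReal.mul_rpow_of_nonneg _ _ hs1.le, ENNReal.div_mul_cancel hS0 hSt]
  have hms : m ^ s = m * m ^ (s - 1) := by
    conv_lhs => rw [show s = 1 + (s - 1) by ring]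
    rw [ENNReal.rpow_add_of_nonneg _ _ zero_le_one hs1.le, ENNReal.rpow_one]
  rw [ENNReal.div_rpow_of_nonneg _ _ hs1.le]
  refine ENNReal.div_le_of_le_mul ?_
  refine (ENNReal.mul_le_mul_iff_right (mul_ne_zero hm0 hV0) (ENNReal.mul_ne_top hmt hVt)).1 ?_
  calc m * V * I ^ (s - 1) = ((I / S) ^ (s - 1) * m) * (V * S ^ (s - 1)) := by rw [hI]; ring
    _ ≤ (M * V) * (K * m ^ s) := mul_le_mul' h1 hAB
    _ = _ := by rw [hms]; ring

/-- The constant in the weighted inequality for the uncentered maximal function. -/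
def muckenhouptConst (D K : ℝ≥0) (s : ℝ) : ℝ≥0∞ :=
  K ^ (s / (s - 1)) * (strongTypeConst (K * D ^ s) (s / (s - 1)) *
    strongTypeConst ((K * D ^ s) ^ (1 / (s - 1))) s) + 1

theorem muckenhouptConst_ne_top (D K : ℝ≥0) (hs : 1 < s) : muckenhouptConst D K s ≠ ∞ := by
  have hs1 : 0 < s - 1 := by linarith
  have h2 : 1 < s / (s - 1) := by rw [one_lt_div hs1]; linarith
  exact ENNReal.add_ne_top.2 ⟨ENNReal.mul_ne_top
    (ENNReal.rpow_ne_top_of_nonneg (by positivity) ENNReal.coe_ne_top)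
    (ENNReal.mul_ne_top (strongTypeConst_ne_top _ h2) (strongTypeConst_ne_top _ hs)),
    ENNReal.one_ne_top⟩

variable [SecondCountableTopology X]

/-- Muckenhoupt's theorem: the uncentered maximal function is bounded on `L^s(v dμ)` whenever
`v` satisfies the `A_s` condition relative to the doubling measure `μ`. -/
theorem IsBallMuckenhoupt.lintegral_uncenteredMaximal_rpow_mul_le
    (hA : IsBallMuckenhoupt μ v s K) (hμ : IsBallDoubling μ D) (hs : 1 < s) (hv : Measurable v)
    {f : X → ℝ≥0∞} (hf : Measurable f) :
    ∫⁻ x, uncenteredMaximal μ f x ^ s * v x ∂μ ≤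
      muckenhouptConst D K s * ∫⁻ x, f x ^ s * v x ∂μ := by
  have hs0 : 0 < s := by linarith
  have hs1 : 0 < s - 1 := by linarith
  by_cases hV : ∀ (c : X) (r : ℝ), 0 < r → ∫⁻ x in ball c r, v x ∂μ ≠ ∞
  swap
  · push Not at hV
    obtain ⟨c, r, hr, h⟩ := hV
    have htop := hA.ae_eq_top hμ hs hv hr h
    by_cases h0 : ∫⁻ x, f x ^ s * v x ∂μ = 0
    · rw [lintegral_eq_zero_iff (by fun_prop)] at h0
      have hf0 : ∀ᵐ x ∂μ, f x = 0 := by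
        filter_upwards [h0, htop] with x h1 h2
        simpa [h2, hs0, hs0.not_gt] using h1
      have hM : ∀ x, uncenteredMaximal μ f x = 0 := by
        intro x
        refine le_antisymm (iSup₂_le fun c r => iSup_le fun _ => ?_) (zero_le)
        rw [(lintegral_congr_ae (ae_restrict_of_ae hf0) : ∫⁻ y in ball c r, f y ∂μ = _)]
        simp
      simp [hM, hs0]
    · have : ∫⁻ x, f x ^ s * v x ∂μ = ∞ := by
        by_contra hne
        refine h0 ?_
        rw [lintegral_eq_zero_iff (by fun_prop)]
        filter_upwards [ae_lt_top (by fun_prop) hne, htop] with x h1 h2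
        by_contra h3
        have h4 : f x ^ s ≠ 0 := fun h5 => h3 (by simp [h5])
        rw [h2, ENNReal.mul_top h4] at h1
        exact h1.ne rfl
      rw [this, ENNReal.mul_top (by simp [muckenhouptConst])]
      exact le_top
  by_cases hS : ∀ (c : X) (r : ℝ), 0 < r → ∫⁻ x in ball c r, v x ^ (-(1 / (s - 1))) ∂μ ≠ ∞
  swap
  · push Not at hS
    obtain ⟨c, r, hr, h⟩ := hS
    have h0 : ∫⁻ x, uncenteredMaximal μ f x ^ s * v x ∂μ = 0 := by
      rw [lintegral_congr_ae (g := fun _ => 0), lintegral_zero]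
      filter_upwards [hA.ae_eq_zero hμ hs hv hr h] with x hx
      rw [hx, mul_zero]
    rw [h0]
    exact zero_le
  have hae := ae_ne_zero_and_ne_top_of_setLIntegral_ball_ne_top hs hv hV hS
  obtain ⟨hdV, hdS⟩ := hA.isBallDoubling_withDensity hμ hs hv hV hS
  have hpt := hA.uncenteredMaximal_rpow_le hμ hs hv hV hS hf
  set σ : X → ℝ≥0∞ := fun z => v z ^ (-(1 / (s - 1))) with hσ
  have hσm : Measurable σ := by fun_prop
  set H := uncenteredMaximal (μ.withDensity σ) (fun z => f z / σ z) with hH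
  have hHm : Measurable H := measurable_uncenteredMaximal _
  set k : X → ℝ≥0∞ := fun y => H y ^ (s - 1) / v y with hk
  have hkm : Measurable k := by fun_prop
  have hMm : Measurable (uncenteredMaximal μ f) := measurable_uncenteredMaximal _
  have ht : 1 < s / (s - 1) := by rw [one_lt_div hs1]; linarith
  have ht0 : 0 < s / (s - 1) := by linarith
  calc ∫⁻ x, uncenteredMaximal μ f x ^ s * v x ∂μ
      = ∫⁻ x, uncenteredMaximal μ f x ^ s ∂(μ.withDensity v) := by
        rw [lintegral_withDensity_eq_lintegral_mul _ hv (by fun_prop)]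
        simp [mul_comm]
    _ ≤ ∫⁻ x, K ^ (s / (s - 1)) * uncenteredMaximal (μ.withDensity v) k x ^ (s / (s - 1))
          ∂(μ.withDensity v) := by
        refine lintegral_mono fun x => ?_
        rw [← ENNReal.mul_rpow_of_nonneg _ _ ht0.le]
        calc uncenteredMaximal μ f x ^ s
            = (uncenteredMaximal μ f x ^ (s - 1)) ^ (s / (s - 1)) := by
              rw [← ENNReal.rpow_mul, mul_div_cancel₀ _ hs1.ne']
          _ ≤ _ := ENNReal.rpow_le_rpow (hpt x) ht0.le
    _ = K ^ (s / (s - 1)) * ∫⁻ x, uncenteredMaximal (μ.withDensity v) k x ^ (s / (s - 1))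
          ∂(μ.withDensity v) :=
        lintegral_const_mul' _ _ (ENNReal.rpow_ne_top_of_nonneg ht0.le ENNReal.coe_ne_top)
    _ ≤ K ^ (s / (s - 1)) * (strongTypeConst (K * D ^ s) (s / (s - 1)) *
          ∫⁻ x, k x ^ (s / (s - 1)) ∂(μ.withDensity v)) :=
        mul_le_mul_right (hdV.lintegral_uncenteredMaximal_rpow_le ht hkm) _
    _ = K ^ (s / (s - 1)) * (strongTypeConst (K * D ^ s) (s / (s - 1)) *
          ∫⁻ x, H x ^ s ∂(μ.withDensity σ)) := by
        rw [lintegral_withDensity_eq_lintegral_mul _ hv (by fun_prop),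
          lintegral_withDensity_eq_lintegral_mul _ hσm (by fun_prop)]
        congr 2
        refine lintegral_congr_ae ?_
        filter_upwards [hae] with x hx
        simp only [Pi.mul_apply, hk, hσ]
        rw [ENNReal.div_rpow_of_nonneg _ _ ht0.le, ← ENNReal.rpow_mul,
          mul_div_cancel₀ _ hs1.ne', ENNReal.div_eq_inv_mul, ← mul_assoc, ← ENNReal.rpow_neg]
        congr 1
        nth_rw 1 [← ENNReal.rpow_one (v x)]
        rw [← ENNReal.rpow_add _ _ hx.1 hx.2]
        congr 1
        field_simp
        ring
    _ ≤ K ^ (s / (s - 1)) * (strongTypeConst (K * D ^ s) (s / (s - 1)) *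
          (strongTypeConst ((K * D ^ s) ^ (1 / (s - 1))) s *
            ∫⁻ x, (f x / σ x) ^ s ∂(μ.withDensity σ))) :=
        mul_le_mul_right (mul_le_mul_right
          (hdS.lintegral_uncenteredMaximal_rpow_le hs (by fun_prop)) _) _
    _ = K ^ (s / (s - 1)) * (strongTypeConst (K * D ^ s) (s / (s - 1)) *
          strongTypeConst ((K * D ^ s) ^ (1 / (s - 1))) s) * ∫⁻ x, f x ^ s * v x ∂μ := by
        rw [lintegral_withDensity_eq_lintegral_mul _ hσm (by fun_prop), mul_assoc, mul_assoc]
        congr 3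
        refine lintegral_congr_ae ?_
        filter_upwards [hae] with x hx
        simp only [Pi.mul_apply, hσ]
        rw [ENNReal.div_rpow_of_nonneg _ _ hs0.le, ENNReal.div_eq_inv_mul, ← mul_assoc,
          ← ENNReal.rpow_mul, ← ENNReal.rpow_neg, ← ENNReal.rpow_add _ _ hx.1 hx.2, mul_comm]
        congr 1
        nth_rw 2 [← ENNReal.rpow_one (v x)]
        congr 1
        field_simp
        ring
    _ ≤ _ := by
        rw [muckenhouptConst]
        gcongr
        exact le_self_add

end WeightedMaximal

theorem mul_rpow_le_of_div_mul_div_rpow_le {V S m K : ℝ≥0∞} {s : ℝ} (hs : 1 < s) (hm0 : m ≠ 0)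
    (hmt : m ≠ ∞) (h : V / m * (S / m) ^ (s - 1) ≤ K) : V * S ^ (s - 1) ≤ K * m ^ s := by
  have hs1 : 0 < s - 1 := by linarith
  have hms : m ^ s = m * m ^ (s - 1) := by
    conv_lhs => rw [show s = 1 + (s - 1) by ring]
    rw [ENNReal.rpow_add_of_nonneg _ _ zero_le_one hs1.le, ENNReal.rpow_one]
  calc V * S ^ (s - 1) = (V / m * m) * ((S / m) * m) ^ (s - 1) := by
        rw [ENNReal.div_mul_cancel hm0 hmt, ENNReal.div_mul_cancel hm0 hmt]
    _ = V / m * (S / m) ^ (s - 1) * m ^ s := by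
        rw [ENNReal.mul_rpow_of_nonneg _ _ hs1.le, hms]
        ring
    _ ≤ K * m ^ s := by gcongr

theorem isBallDoubling_volume (n : ℕ) :
    IsBallDoubling (volume : Measure (EuclideanSpace ℝ (Fin n))) (6 ^ n) where
  ne_zero c r hr := (measure_ball_pos volume c hr).ne'
  ne_top c r _ := measure_ball_lt_top.ne
  doubling c r _ := by
    rw [Measure.addHaar_ball_mul_of_pos volume c (by norm_num : (0 : ℝ) < 6) r,
      ← Measure.addHaar_ball_center volume c r, finrank_euclideanSpace_fin,
      ENNReal.ofReal_pow (by norm_num)]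
    simp

/-- A weight in `A_q` defines a doubling measure. -/
theorem apBound.isBallDoubling {n : ℕ} {w : EuclideanSpace ℝ (Fin n) → ℝ≥0∞} {q : ℝ} {C : ℝ≥0}
    (h : apBound n w q C) (hq : 1 ≤ q) (hw : Measurable w)
    (hball : ∀ (c : EuclideanSpace ℝ (Fin n)) (r : ℝ), 0 < r →
      0 < (∫⁻ x in ball c r, w x) ∧ (∫⁻ x in ball c r, w x) ≠ ∞) :
    IsBallDoubling (volume.withDensity w) (C * (6 ^ n) ^ q) := by
  have hvol := isBallDoubling_volume n
  rcases hq.eq_or_lt with rfl | hq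
  · refine ⟨fun c r hr => ?_, fun c r hr => ?_, fun c r hr => ?_⟩
    · rw [withDensity_apply _ measurableSet_ball]; exact (hball c r hr).1.ne'
    · rw [withDensity_apply _ measurableSet_ball]; exact (hball c r hr).2
    · rw [withDensity_apply _ measurableSet_ball, withDensity_apply _ measurableSet_ball]
      have h6 : 0 < 6 * r := by positivity
      have hC := h c (6 * r) h6
      rw [if_pos rfl] at hC
      have hm0 := hvol.ne_zero c r hr
      have hmt := hvol.ne_top c r hr
      have hm0' := hvol.ne_zero c _ h6
      have hmt' := hvol.ne_top c _ h6
      obtain ⟨hW0, hWt⟩ := hball c (6 * r) h6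
      have hE := ENNReal.ae_le_essSup (μ := volume.restrict (ball c (6 * r))) fun x => (w x)⁻¹
      set E := essSup (fun x => (w x)⁻¹) (volume.restrict (ball c (6 * r)))
      have hEt : E ≠ ∞ := by
        intro hE
        rw [hE, ENNReal.mul_top (ENNReal.div_pos hW0.ne' hmt').ne'] at hC
        exact ENNReal.coe_ne_top (top_le_iff.1 hC)
      have hsub : ball c r ⊆ ball c (6 * r) := ball_subset_ball (by linarith)
      have hmE : volume (ball c r) ≤ E * ∫⁻ x in ball c r, w x := by
        rw [← setLIntegral_one, ← lintegral_const_mul _ hw]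
        refine lintegral_mono_ae ?_
        filter_upwards [ae_restrict_of_ae_restrict_of_subset hsub hE,
          ae_lt_top hw (hball c r hr).2] with x hx hxt
        have hx0 : w x ≠ 0 := by
          rintro h0
          rw [h0, ENNReal.inv_zero] at hx
          exact hEt (top_le_iff.1 hx)
        rw [← ENNReal.inv_mul_cancel hx0 hxt.ne]
        gcongr
      refine (ENNReal.mul_le_mul_iff_right hm0 hmt).1 ?_
      calc volume (ball c r) * ∫⁻ x in ball c (6 * r), w x
          ≤ (E * ∫⁻ x in ball c r, w x) * ∫⁻ x in ball c (6 * r), w x := by gcongr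
        _ = ((∫⁻ x in ball c (6 * r), w x) / volume (ball c (6 * r)) * E) *
              (volume (ball c (6 * r)) * ∫⁻ x in ball c r, w x) := by
            nth_rw 1 [← ENNReal.div_mul_cancel hm0' hmt' (b := ∫⁻ x in ball c (6 * r), w x)]
            ring
        _ ≤ C * (((6 ^ n : ℝ≥0) * volume (ball c r)) * ∫⁻ x in ball c r, w x) := by
            gcongr
            exact hvol.doubling c r hr
        _ = _ := by
            rw [NNReal.rpow_one, ENNReal.coe_mul]
            ring
  · have hq1 : 0 < q - 1 := by linarith
    have hA : IsBallMuckenhoupt volume w q C := by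
      intro c r hr
      refine mul_rpow_le_of_div_mul_div_rpow_le hq (hvol.ne_zero c r hr) (hvol.ne_top c r hr) ?_
      have := h c r hr
      rwa [if_neg hq.ne'] at this
    refine (hA.isBallDoubling_withDensity hvol hq hw (fun c r hr => (hball c r hr).2)
      fun c r hr htop => ?_).1
    have := hA c r hr
    rw [htop, ENNReal.top_rpow_of_pos hq1, ENNReal.mul_top (hball c r hr).1.ne'] at this
    exact ENNReal.mul_ne_top ENNReal.coe_ne_top (ENNReal.rpow_ne_top_of_nonneg (by linarith)
      (hvol.ne_top c r hr)) (top_le_iff.1 this)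

theorem apBoundW.isBallMuckenhoupt {n : ℕ} {w v : EuclideanSpace ℝ (Fin n) → ℝ≥0∞} {s : ℝ}
    {K : ℝ≥0} (h : apBoundW n w v s K) (hs : 1 < s) (hw : Measurable w) (hv : Measurable v)
    (hball : ∀ (c : EuclideanSpace ℝ (Fin n)) (r : ℝ), 0 < r →
      0 < (∫⁻ x in ball c r, w x) ∧ (∫⁻ x in ball c r, w x) ≠ ∞) :
    IsBallMuckenhoupt (volume.withDensity w) v s K := by
  intro c r hr
  obtain ⟨h0, ht⟩ := hball c r hr
  have := h c r hr
  rw [if_neg hs.ne'] at this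
  rw [withDensity_apply _ measurableSet_ball, restrict_withDensity measurableSet_ball,
    lintegral_withDensity_eq_lintegral_mul _ hw hv,
    lintegral_withDensity_eq_lintegral_mul _ hw (by fun_prop)]
  simp only [Pi.mul_apply, mul_comm (w _)]
  exact mul_rpow_le_of_div_mul_div_rpow_le hs h0.ne' ht this

theorem innerCone_rpow_le_coneA_rpow (n : ℕ) (w : EuclideanSpace ℝ (Fin n) → ℝ≥0∞)
    (F : EuclideanSpace ℝ (Fin n) → ℝ → ℂ) {p0 : ℝ} (hp0 : 0 < p0) (r : ℝ)
    (x : EuclideanSpace ℝ (Fin n)) :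
    innerCone n w F r x ^ (p0 / 2) ≤ coneA n w F x ^ p0 := by
  rw [coneA, ← ENNReal.rpow_mul, show (1 : ℝ) / 2 * p0 = p0 / 2 by ring]
  exact ENNReal.rpow_le_rpow (lintegral_mono_set Ioc_subset_Ioi_self) (by positivity)

/-- The Carleson-type operator is dominated by the maximal function of any function with the same
averages over balls as `(𝒜_w F) ^ p₀`. -/
theorem carlWp_le_uncenteredMaximal_rpow {n : ℕ} {w : EuclideanSpace ℝ (Fin n) → ℝ≥0∞}
    (hw : Measurable w) (hwt : ∀ᵐ x, w x < ∞) (F : EuclideanSpace ℝ (Fin n) → ℝ → ℂ) {p0 : ℝ}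
    (hp0 : 0 < p0) {g : EuclideanSpace ℝ (Fin n) → ℝ≥0∞}
    (hg : ∀ t, ∫⁻ x in t, coneA n w F x ^ p0 ∂(volume.withDensity w) =
      ∫⁻ x in t, g x ∂(volume.withDensity w)) (x : EuclideanSpace ℝ (Fin n)) :
    carlWp n w F p0 x ≤ uncenteredMaximal (volume.withDensity w) g x ^ (1 / p0) := by
  refine iSup₂_le fun c r => iSup_le fun hx => ?_
  refine ENNReal.rpow_le_rpow (le_trans ?_ (le_uncenteredMaximal g hx.2)) (by positivity)
  rw [withDensity_apply _ measurableSet_ball, ← hg, restrict_withDensity measurableSet_ball,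
    lintegral_withDensity_eq_lintegral_mul_non_measurable _ hw (ae_restrict_of_ae hwt)]
  refine ENNReal.div_le_div_right (lintegral_mono fun y => ?_) _
  rw [Pi.mul_apply, mul_comm]
  exact mul_le_mul_right (innerCone_rpow_le_coneA_rpow n w F hp0 r y) _

/-- for `w ∈ A_∞`, `0 < p₀ < p < ∞` and `v ∈ A_{p/p₀}(w)`,
`‖𝒞_{w,p₀} F‖_{L^p(v dw)} ≲ ‖𝒜_w F‖_{L^p(v dw)}`. -/
theorem carleson_dominated_by_cone
    (n : ℕ) (p0 p q : ℝ) (hp0 : 0 < p0) (hp : p0 < p) (hq : 1 ≤ q) (Cq Cv : ℝ≥0) :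
    ∃ C : ℝ≥0, ∀ (w v : EuclideanSpace ℝ (Fin n) → ℝ≥0∞)
      (F : EuclideanSpace ℝ (Fin n) → ℝ → ℂ),
      Measurable w → Measurable v →
      (∀ (c : EuclideanSpace ℝ (Fin n)) (r : ℝ), 0 < r →
        0 < (∫⁻ x in ball c r, w x) ∧ (∫⁻ x in ball c r, w x) ≠ ∞) →
      apBound n w q Cq → apBoundW n w v (p/p0) Cv →
      (∫⁻ x, (carlWp n w F p0 x) ^ p * (v x * w x)) ^ (1/p) ≤
        C * (∫⁻ x, (coneA n w F x) ^ p * (v x * w x)) ^ (1/p) := by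
  have hs : 1 < p / p0 := by rwa [one_lt_div hp0]
  have hp' : 0 < p := hp0.trans hp
  set D : ℝ≥0 := Cq * (6 ^ n) ^ q
  have hC := muckenhouptConst_ne_top D Cv hs
  refine ⟨(muckenhouptConst D Cv (p / p0) ^ (1 / p)).toNNReal, ?_⟩
  intro w v F hw hv hball hwq hvs
  rw [ENNReal.coe_toNNReal (ENNReal.rpow_ne_top_of_nonneg (by positivity) hC),
    ← ENNReal.mul_rpow_of_nonneg _ _ (by positivity)]
  refine ENNReal.rpow_le_rpow ?_ (by positivity)
  have hμ : IsBallDoubling (volume.withDensity w) D := hwq.isBallDoubling hq hw hball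
  have hA := hvs.isBallMuckenhoupt hs hw hv hball
  have hwt : ∀ᵐ x, w x < ∞ := ae_of_forall_ae_restrict_ball 0 1 fun R hR =>
    ae_lt_top hw (hball 0 R (by linarith)).2
  have := hμ.isLocallyFiniteMeasure
  obtain ⟨g, hgm, hgle, hg⟩ := exists_measurable_le_forall_setLIntegral_eq
    (volume.withDensity w) fun x => coneA n w F x ^ p0
  have hconv : ∀ u : EuclideanSpace ℝ (Fin n) → ℝ≥0∞, Measurable u →
      ∫⁻ x, u x ^ (p / p0) * v x ∂(volume.withDensity w) =
        ∫⁻ x, u x ^ (p / p0) * (v x * w x) := by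
    intro u hu
    rw [lintegral_withDensity_eq_lintegral_mul _ hw (by fun_prop)]
    refine lintegral_congr fun x => ?_
    rw [Pi.mul_apply]
    ring
  calc ∫⁻ x, carlWp n w F p0 x ^ p * (v x * w x)
      ≤ ∫⁻ x, uncenteredMaximal (volume.withDensity w) g x ^ (p / p0) * (v x * w x) := by
        refine lintegral_mono fun x => ?_
        dsimp only
        gcongr
        refine (ENNReal.rpow_le_rpow (carlWp_le_uncenteredMaximal_rpow hw hwt F hp0 hg x)
          hp'.le).trans ?_
        rw [← ENNReal.rpow_mul, one_div_mul_eq_div]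
    _ = ∫⁻ x, uncenteredMaximal (volume.withDensity w) g x ^ (p / p0) * v x
          ∂(volume.withDensity w) := (hconv _ (measurable_uncenteredMaximal g)).symm
    _ ≤ muckenhouptConst D Cv (p / p0) *
          ∫⁻ x, g x ^ (p / p0) * v x ∂(volume.withDensity w) :=
        hA.lintegral_uncenteredMaximal_rpow_mul_le hμ hs hv hgm
    _ = muckenhouptConst D Cv (p / p0) * ∫⁻ x, g x ^ (p / p0) * (v x * w x) := by
        rw [hconv g hgm]
    _ ≤ muckenhouptConst D Cv (p / p0) * ∫⁻ x, coneA n w F x ^ p * (v x * w x) := by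
        gcongr with x
        refine (ENNReal.rpow_le_rpow (hgle x) (by positivity)).trans ?_
        rw [← ENNReal.rpow_mul, mul_div_cancel₀ _ hp0.ne']
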